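/- Let A = (a_{ij}) be an indecomposable symmetric generalized n×n Cartan matrix and let c = σ_{v_n}⋯σ_{v_1} be any Coxeter element of the Weyl group W, i.e. v_1,…,v_n is a permutation of 1,…,n. Then W is infinite if and only if ℓ(c^m) = |m|·n for every integer m. -/

import Mathlib

namespace KP

/-! ## Quivers on a fixed vertex set `Fin n`.

An orientation is encoded by `Λ : Fin n → Fin n → ℕ`, where `Λ a b` is the number of
arrows from `a` to `b`.  The underlying graph is recorded by `edges Λ a b = Λ a b + Λ b a`. -/

/-- The orientation `σ_x Λ` obtained by reversing every arrow incident with `x`. -/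
def flipO {n : ℕ} (x : Fin n) (Λ : Fin n → Fin n → ℕ) : Fin n → Fin n → ℕ :=
  fun a b => if a = x ∨ b = x then Λ b a else Λ a b

/-- Number of edges of the underlying graph joining `a` and `b`. -/
def edges {n : ℕ} (Λ : Fin n → Fin n → ℕ) (a b : Fin n) : ℕ := Λ a b + Λ b a

/-- `x` is a sink: no arrow starts at `x`. -/
def IsSink {n : ℕ} (Λ : Fin n → Fin n → ℕ) (x : Fin n) : Prop := ∀ y, Λ x y = 0

/-- `S` is a `(+)`-admissible sequence of vertices on `(Γ, Λ)`. -/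
def Admissible {n : ℕ} (Λ : Fin n → Fin n → ℕ) : List (Fin n) → Prop
  | [] => True
  | x :: xs => IsSink Λ x ∧ Admissible (flipO x Λ) xs

/-- The orientation `Λ^S`. -/
def orientAfter {n : ℕ} (Λ : Fin n → Fin n → ℕ) : List (Fin n) → (Fin n → Fin n → ℕ)
  | [] => Λ
  | x :: xs => orientAfter (flipO x Λ) xs

/-- Elementary move: interchange two consecutive vertices not joined by an edge. -/
inductive SwapRel {n : ℕ} (E : Fin n → Fin n → ℕ) : List (Fin n) → List (Fin n) → Prop
  | swap (l₁ l₂ : List (Fin n)) (a b : Fin n) (h : E a b = 0) :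
      SwapRel E (l₁ ++ a :: b :: l₂) (l₁ ++ b :: a :: l₂)

/-- The equivalence `∼` on sequences of vertices: reflexive–transitive closure of the
(symmetric) relation `SwapRel`. -/
def Sim {n : ℕ} (E : Fin n → Fin n → ℕ) : List (Fin n) → List (Fin n) → Prop :=
  Relation.ReflTransGen (SwapRel E)

/-- The preorder `S ⪯ T` : `T ∼ S ++ U` for some `(+)`-admissible sequence `U` on `(Γ, Λ^S)`. -/
def Preceq {n : ℕ} (Λ : Fin n → Fin n → ℕ) (S T : List (Fin n)) : Prop :=
  ∃ U, Admissible (orientAfter Λ S) U ∧ Sim (edges Λ) T (S ++ U)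

/-- Support of a sequence of vertices. -/
def suppOf {n : ℕ} (S : List (Fin n)) : Set (Fin n) := {v | v ∈ S}

/-- The partial order on vertices: `x ≤ y` iff there is a path from `x` to `y` in `(Γ, Λ)`. -/
def PathLE {n : ℕ} (Λ : Fin n → Fin n → ℕ) (x y : Fin n) : Prop :=
  Relation.ReflTransGen (fun a b => Λ a b ≠ 0) x y

/-- A filter (up-closed set) of the poset `(Γ₀, Λ)`. -/
def IsFilter {n : ℕ} (Λ : Fin n → Fin n → ℕ) (F : Set (Fin n)) : Prop :=
  ∀ x ∈ F, ∀ y, PathLE Λ x y → y ∈ F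

/-- The principal filter `⟨x⟩`. -/
def upSet {n : ℕ} (Λ : Fin n → Fin n → ℕ) (x : Fin n) : Set (Fin n) := {y | PathLE Λ x y}

/-- The hull `H_Λ(F)`: the smallest filter containing `F` and every vertex joined
by an edge to a vertex of `F`. -/
def hull {n : ℕ} (Λ : Fin n → Fin n → ℕ) (F : Set (Fin n)) : Set (Fin n) :=
  {y | ∃ x, (x ∈ F ∨ ∃ z ∈ F, edges Λ z x ≠ 0) ∧ PathLE Λ x y}

/-- `segs` is a canonical form of `S` (Proposition 2.1): `S ∼ S₁S₂⋯S_r`, each segment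
consists of distinct vertices, is nonempty, and `Supp S_i = Supp (S_i S_{i+1} ⋯ S_r)`. -/
def Segments {n : ℕ} (Λ : Fin n → Fin n → ℕ) (S : List (Fin n))
    (segs : List (List (Fin n))) : Prop :=
  Admissible Λ segs.flatten ∧ Sim (edges Λ) S segs.flatten ∧
  (∀ seg ∈ segs, seg ≠ [] ∧ seg.Nodup) ∧
  ∀ i, i < segs.length → suppOf (segs.getD i []) = suppOf ((segs.drop i).flatten)

/-- `J` is (a representative of) the join `S ∨ T` (Definition 2.4):  the canonical form of `J`
has `Supp R_i = Supp S_i ∪ Supp T_i` (out-of-range segments read as `∅`). -/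
def IsJoin {n : ℕ} (Λ : Fin n → Fin n → ℕ) (S T J : List (Fin n)) : Prop :=
  ∃ CS CT CJ, Segments Λ S CS ∧ Segments Λ T CT ∧ Segments Λ J CJ ∧
    ∀ i, suppOf (CJ.getD i []) = suppOf (CS.getD i []) ∪ suppOf (CT.getD i [])

/-- `M` is (a representative of) the meet `S ∧ T` (Definition 2.4). -/
def IsMeet {n : ℕ} (Λ : Fin n → Fin n → ℕ) (S T M : List (Fin n)) : Prop :=
  ∃ CS CT CM, Segments Λ S CS ∧ Segments Λ T CT ∧ Segments Λ M CM ∧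
    ∀ i, suppOf (CM.getD i []) = suppOf (CS.getD i []) ∩ suppOf (CT.getD i [])

/-- `S` is (equivalent to) the join `T₁ ∨ ⋯ ∨ T_l` of the list of sequences `Ts`. -/
def IsJoinList {n : ℕ} (Λ : Fin n → Fin n → ℕ) : List (List (Fin n)) → List (Fin n) → Prop
  | [], S => S = []
  | T :: Ts, S => ∃ J, IsJoinList Λ Ts J ∧ IsJoin Λ T J S

/-- The segments of a canonical form of a principal sequence `S_{r,x}` (Definition 3.1). -/
def PrincipalSegs {n : ℕ} (Λ : Fin n → Fin n → ℕ) (segs : List (List (Fin n)))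
    (r : ℕ) (x : Fin n) : Prop :=
  segs.length = r ∧ 0 < r ∧
  (∀ i, i + 1 < r → suppOf (segs.getD i []) = hull Λ (suppOf (segs.getD (i+1) []))) ∧
  suppOf (segs.getD (r-1) []) = upSet Λ x

/-- `S ∼ S_{r,x}`, the principal `(+)`-admissible sequence of size `r` with
`Supp S_r = ⟨x⟩`. -/
def IsPrincipalSeq {n : ℕ} (Λ : Fin n → Fin n → ℕ) (r : ℕ) (x : Fin n)
    (S : List (Fin n)) : Prop :=
  ∃ segs, Segments Λ S segs ∧ PrincipalSegs Λ segs r x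

/-- `S` is a principal `(+)`-admissible sequence. -/
def IsPrincipal {n : ℕ} (Λ : Fin n → Fin n → ℕ) (S : List (Fin n)) : Prop :=
  ∃ r x, IsPrincipalSeq Λ r x S


/-! ## Representations of `(Γ, Λ)` over a field `k`. -/

/-- A (finite-dimensional) representation of the quiver `(Γ, Λ)` over `k`:
the space at vertex `x` is `Fin (d x) → k`, and each arrow carries a linear map. -/
structure Rep (k : Type) [Field k] (n : ℕ) (Λ : Fin n → Fin n → ℕ) where
  d : Fin n → ℕ
  f : ∀ a b : Fin n, Fin (Λ a b) → ((Fin (d a) → k) →ₗ[k] (Fin (d b) → k))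

variable {k : Type} [Field k] {n : ℕ}

/-- A morphism of representations. -/
structure RepHom {Λ : Fin n → Fin n → ℕ} (M N : Rep k n Λ) where
  g : ∀ x, (Fin (M.d x) → k) →ₗ[k] (Fin (N.d x) → k)
  comm : ∀ a b i v, g b (M.f a b i v) = N.f a b i (g a v)

/-- Isomorphism of representations. -/
def RepIso {Λ : Fin n → Fin n → ℕ} (M N : Rep k n Λ) : Prop :=
  ∃ g : ∀ x, (Fin (M.d x) → k) ≃ₗ[k] (Fin (N.d x) → k),
    ∀ a b i v, g b (M.f a b i v) = N.f a b i (g a v)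

/-- The zero representation. -/
def IsZeroRep {Λ : Fin n → Fin n → ℕ} (M : Rep k n Λ) : Prop := ∀ x, M.d x = 0

/-- Cast between the standard spaces. -/
def castL (k : Type) [Field k] {m m' : ℕ} (h : m = m') : (Fin m → k) ≃ₗ[k] (Fin m' → k) :=
  LinearEquiv.funCongrLeft k k (finCongr h.symm)

/-- The splitting `(Fin (m + p) → k) ≃ₗ (Fin m → k) × (Fin p → k)`. -/
def splitL (k : Type) [Field k] (m p : ℕ) : (Fin (m + p) → k) ≃ₗ[k] (Fin m → k) × (Fin p → k) :=
  (LinearEquiv.funCongrLeft k k finSumFinEquiv).trans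
    (LinearEquiv.sumArrowLequivProdArrow _ _ k k)

/-- Direct sum of two representations. -/
def dSum {Λ : Fin n → Fin n → ℕ} (M N : Rep k n Λ) : Rep k n Λ where
  d x := M.d x + N.d x
  f a b i :=
    (splitL k (M.d b) (N.d b)).symm.toLinearMap ∘ₗ
      (LinearMap.prodMap (M.f a b i) (N.f a b i)) ∘ₗ (splitL k (M.d a) (N.d a)).toLinearMap

/-- The zero representation (as an object). -/
def zeroRep (k : Type) [Field k] (n : ℕ) (Λ : Fin n → Fin n → ℕ) : Rep k n Λ where
  d _ := 0
  f _ _ _ := 0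

/-- Direct sum of a list of representations. -/
def dSumList {Λ : Fin n → Fin n → ℕ} (L : List (Rep k n Λ)) : Rep k n Λ :=
  L.foldr dSum (zeroRep k n Λ)

/-- `M` is indecomposable. -/
def Indecomp {Λ : Fin n → Fin n → ℕ} (M : Rep k n Λ) : Prop :=
  ¬ IsZeroRep M ∧ ∀ A B : Rep k n Λ, RepIso M (dSum A B) → IsZeroRep A ∨ IsZeroRep B

/-- `X` is a direct summand of `M`. -/
def IsSummand {Λ : Fin n → Fin n → ℕ} (X M : Rep k n Λ) : Prop :=
  ∃ Y, RepIso M (dSum X Y)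

/-! ### Reflection functors (on objects) -/

/-- Index type of the arrows ending at `x`. -/
abbrev Arin {n : ℕ} (Λ : Fin n → Fin n → ℕ) (x : Fin n) := Σ y : Fin n, Fin (Λ y x)

/-- Index type of the arrows starting at `x`. -/
abbrev Aout {n : ℕ} (Λ : Fin n → Fin n → ℕ) (x : Fin n) := Σ y : Fin n, Fin (Λ x y)

/-- The map `h : ⊕_{a : y → x} V(y) → V(x)` induced by the maps along the arrows ending at `x`. -/
noncomputable def inMap (Λ : Fin n → Fin n → ℕ) (M : Rep k n Λ) (x : Fin n) :
    ((p : Arin Λ x) → (Fin (M.d p.1) → k)) →ₗ[k] (Fin (M.d x) → k) :=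
  ∑ p : Arin Λ x, (M.f p.1 x p.2) ∘ₗ LinearMap.proj p

/-- The map `h' : V(x) → ⊕_{a : x → y} V(y)` induced by the maps along arrows starting at `x`. -/
def outMap (Λ : Fin n → Fin n → ℕ) (M : Rep k n Λ) (x : Fin n) :
    (Fin (M.d x) → k) →ₗ[k] ((p : Aout Λ x) → (Fin (M.d p.1) → k)) :=
  LinearMap.pi fun p => M.f x p.1 p.2

noncomputable def kerEquiv (Λ : Fin n → Fin n → ℕ) (M : Rep k n Λ) (x : Fin n) :
    LinearMap.ker (inMap Λ M x) ≃ₗ[k]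
      (Fin (Module.finrank k (LinearMap.ker (inMap Λ M x))) → k) :=
  (Module.finBasis k _).equivFun

noncomputable def cokerEquiv (Λ : Fin n → Fin n → ℕ) (M : Rep k n Λ) (x : Fin n) :
    (((p : Aout Λ x) → (Fin (M.d p.1) → k)) ⧸ LinearMap.range (outMap Λ M x)) ≃ₗ[k]
      (Fin (Module.finrank k (((p : Aout Λ x) → (Fin (M.d p.1) → k)) ⧸
        LinearMap.range (outMap Λ M x))) → k) :=
  (Module.finBasis k _).equivFun

/-- The positive reflection functor `F_x⁺` (on objects): the space at `x` is replaced
by the kernel of `inMap`, with the maps along the reversed arrows induced by inclusion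
followed by the projections. -/
noncomputable def reflPlus (x : Fin n) (Λ : Fin n → Fin n → ℕ) (M : Rep k n Λ) :
    Rep k n (flipO x Λ) where
  d z := if z = x then Module.finrank k (LinearMap.ker (inMap Λ M x)) else M.d z
  f a b i :=
    if ha : a = x then
      if hb : b = x then 0
      else
        (castL k (if_neg hb).symm).toLinearMap ∘ₗ
          (LinearMap.proj (φ := fun p : Arin Λ x => Fin (M.d p.1) → k)
            (⟨b, Fin.cast (by subst ha; simp [flipO]) i⟩ : Arin Λ x)) ∘ₗ
          (LinearMap.ker (inMap Λ M x)).subtype ∘ₗ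
          (kerEquiv Λ M x).symm.toLinearMap ∘ₗ (castL k (if_pos ha)).toLinearMap
    else
      if hb : b = x then 0
      else
        (castL k (if_neg hb).symm).toLinearMap ∘ₗ
          M.f a b (Fin.cast (by simp [flipO, ha, hb]) i) ∘ₗ
          (castL k (if_neg ha)).toLinearMap

/-- The negative reflection functor `F_x⁻` (on objects), presented as a map from
representations of `(Γ, σ_x Λ)` to representations of `(Γ, Λ)`: the space at `x` is
replaced by the cokernel of `outMap`. -/
noncomputable def reflMinus (x : Fin n) (Λ : Fin n → Fin n → ℕ)
    (N : Rep k n (flipO x Λ)) : Rep k n Λ where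
  d z := if z = x then
      Module.finrank k (((p : Aout (flipO x Λ) x) → (Fin (N.d p.1) → k)) ⧸
        LinearMap.range (outMap (flipO x Λ) N x))
    else N.d z
  f a b i :=
    if hb : b = x then
      if ha : a = x then 0
      else
        (castL k (if_pos hb).symm).toLinearMap ∘ₗ
          (cokerEquiv (flipO x Λ) N x).toLinearMap ∘ₗ
          (LinearMap.range (outMap (flipO x Λ) N x)).mkQ ∘ₗ
          (LinearMap.single k (fun p : Aout (flipO x Λ) x => Fin (N.d p.1) → k)
            (⟨a, Fin.cast (by subst hb; simp [flipO]) i⟩ : Aout (flipO x Λ) x)) ∘ₗ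
          (castL k (if_neg ha)).toLinearMap
    else
      if ha : a = x then 0
      else
        (castL k (if_neg hb).symm).toLinearMap ∘ₗ
          N.f a b (Fin.cast (by simp [flipO, ha, hb]) i) ∘ₗ
          (castL k (if_neg ha)).toLinearMap

/-- `F(S) = F_{x_s}⁺ ⋯ F_{x_1}⁺` applied to a representation. -/
noncomputable def FList : (S : List (Fin n)) → (Λ : Fin n → Fin n → ℕ) → Rep k n Λ →
    Rep k n (orientAfter Λ S)
  | [], _, M => M
  | x :: xs, Λ, M => FList xs (flipO x Λ) (reflPlus x Λ M)

/-- `S` annihilates `M` : `F(S) M = 0`. -/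
def Annihilates (Λ : Fin n → Fin n → ℕ) (S : List (Fin n)) (M : Rep k n Λ) : Prop :=
  IsZeroRep (FList S Λ M)

/-- `M` is preprojective: some `(+)`-admissible sequence annihilates it. -/
def Preprojective (Λ : Fin n → Fin n → ℕ) (M : Rep k n Λ) : Prop :=
  ∃ S, Admissible Λ S ∧ Annihilates Λ S M

/-- `S` is a shortest `(+)`-admissible sequence annihilating `M` : it annihilates `M` and no
proper subsequence of `S` annihilates `M`.  (This predicate is invariant under `∼`, so it
expresses `S ∼ S_M`.) -/
def IsShortestAnn (Λ : Fin n → Fin n → ℕ) (M : Rep k n Λ) (S : List (Fin n)) : Prop :=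
  Admissible Λ S ∧ Annihilates Λ S M ∧
  ∀ S', Admissible Λ S' → Annihilates Λ S' M → Preceq Λ S' S → Sim (edges Λ) S' S

/-- The simple representation `L_x` concentrated at the vertex `x`. -/
def simpleRep (Λ : Fin n → Fin n → ℕ) (x : Fin n) : Rep k n Λ where
  d z := if z = x then 1 else 0
  f _ _ _ := 0

/-- `M(S) = F_{x₁}⁻ F_{x₂}⁻ ⋯ F_{x_{s-1}}⁻ (L_{x_s})`, where `L_{x_s}` is the simple
(projective) module over `k(Γ, σ_{x_{s-1}} ⋯ σ_{x_1} Λ)` at the vertex `x_s`. -/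
noncomputable def Mof : (Λ : Fin n → Fin n → ℕ) → (S : List (Fin n)) → Rep k n Λ
  | Λ, [] => zeroRep k n Λ
  | Λ, [x] => simpleRep Λ x
  | Λ, x :: y :: ys => reflMinus x Λ (Mof (flipO x Λ) (y :: ys))

variable {n : ℕ}

/-! ## The Weyl group -/

/-- The simple reflection `σ_i` attached to a generalized Cartan matrix `A`,
as a linear endomorphism of `ℤⁿ` : `σ_i(v) = v - (∑ l, a_{il} v_l) e_i`. -/
def sigmaL (A : Fin n → Fin n → ℤ) (i : Fin n) : (Fin n → ℤ) →ₗ[ℤ] (Fin n → ℤ) where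
  toFun v := v - (∑ l, A i l * v l) • Pi.single i 1
  map_add' v w := by
    simp only [Pi.add_apply, mul_add, Finset.sum_add_distrib, add_smul]
    abel
  map_smul' c v := by
    simp only [Pi.smul_apply, smul_eq_mul, RingHom.id_apply, smul_sub]
    congr 1
    rw [smul_smul, Finset.mul_sum]
    congr 1
    exact Finset.sum_congr rfl fun l _ => by ring

theorem sigma_invol (A : Fin n → Fin n → ℤ) (hA : ∀ i, A i i = 2) (i : Fin n) :
    (sigmaL A i).comp (sigmaL A i) = LinearMap.id := by
  apply LinearMap.ext
  intro v
  simp only [LinearMap.comp_apply, LinearMap.id_apply, sigmaL, LinearMap.coe_mk, AddHom.coe_mk]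
  set c := ∑ l, A i l * v l with hc
  set s : Fin n → ℤ := Pi.single i 1 with hs
  have h1 : ∑ l, A i l * (v - c • s) l = -c := by
    have h2 : ∀ l, A i l * (v - c • s) l = A i l * v l - c * (A i l * s l) := fun l => by
      simp only [Pi.sub_apply, Pi.smul_apply, smul_eq_mul]
      ring
    rw [Finset.sum_congr rfl fun l _ => h2 l, Finset.sum_sub_distrib, ← Finset.mul_sum]
    have h3 : ∑ l, A i l * s l = 2 := by
      rw [Finset.sum_eq_single i]
      · simp [hs, hA i]
      · intro b _ hb
        simp [hs, Pi.single_eq_of_ne hb]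
      · simp
    rw [h3, ← hc]
    ring
  rw [h1]
  ext j
  simp only [Pi.sub_apply, Pi.smul_apply, smul_eq_mul]
  ring

/-- The simple reflection `σ_i` as an automorphism of `ℤⁿ`. -/
def sigmaE (A : Fin n → Fin n → ℤ) (hA : ∀ i, A i i = 2) (i : Fin n) :
    (Fin n → ℤ) ≃ₗ[ℤ] (Fin n → ℤ) :=
  LinearEquiv.ofLinear (sigmaL A i) (sigmaL A i) (sigma_invol A hA i) (sigma_invol A hA i)

/-- The length `ℓ(w)`: the least `l ≥ 0` such that `w` is a product of `l` simple
reflections. -/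
noncomputable def wordLen (A : Fin n → Fin n → ℤ) (hA : ∀ i, A i i = 2)
    (w : (Fin n → ℤ) ≃ₗ[ℤ] (Fin n → ℤ)) : ℕ :=
  sInf {l | ∃ ys : List (Fin n), ys.length = l ∧ w = (ys.map (sigmaE A hA)).prod}

/-- The word `w(S) = σ_{x_s} ⋯ σ_{x_1}` associated to a sequence `S = x₁, …, x_s`. -/
def wordOf (A : Fin n → Fin n → ℤ) (hA : ∀ i, A i i = 2) (S : List (Fin n)) :
    (Fin n → ℤ) ≃ₗ[ℤ] (Fin n → ℤ) :=
  ((S.reverse).map (sigmaE A hA)).prod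

/-- The symmetric generalized Cartan matrix of the underlying graph of `(Γ, Λ)`. -/
def cartanOf (Λ : Fin n → Fin n → ℕ) : Fin n → Fin n → ℤ :=
  fun i j => if i = j then 2 else -(edges Λ i j : ℤ)

theorem cartan_diag (Λ : Fin n → Fin n → ℕ) : ∀ i, cartanOf Λ i i = 2 := by
  intro i; simp [cartanOf]

/-- The simple reflections of the Weyl group of the underlying graph of `(Γ, Λ)`. -/
def wSig (Λ : Fin n → Fin n → ℕ) : Fin n → ((Fin n → ℤ) ≃ₗ[ℤ] (Fin n → ℤ)) :=
  sigmaE (cartanOf Λ) (cartan_diag Λ)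

/-- `w(S)` for a sequence of vertices of `(Γ, Λ)`. -/
def wordOfSeq (Λ : Fin n → Fin n → ℕ) (S : List (Fin n)) :
    (Fin n → ℤ) ≃ₗ[ℤ] (Fin n → ℤ) :=
  ((S.reverse).map (wSig Λ)).prod

/-- The word `w(S)` is reduced: `ℓ(w(S))` equals the number of letters of `S`. -/
noncomputable def IsReducedSeq (Λ : Fin n → Fin n → ℕ) (S : List (Fin n)) : Prop :=
  wordLen (cartanOf Λ) (cartan_diag Λ) (wordOfSeq Λ S) = S.length

/-! ## Dynkin graphs of types A, D, E -/

def edgeA (n : ℕ) : Fin n → Fin n → ℕ := fun i j =>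
  if (i : ℕ) + 1 = (j : ℕ) ∨ (j : ℕ) + 1 = (i : ℕ) then 1 else 0

def edgeD (n : ℕ) : Fin n → Fin n → ℕ := fun i j =>
  if ((i : ℕ) = 0 ∧ (j : ℕ) = 2) ∨ ((j : ℕ) = 0 ∧ (i : ℕ) = 2) ∨
     ((i : ℕ) = 1 ∧ (j : ℕ) = 2) ∨ ((j : ℕ) = 1 ∧ (i : ℕ) = 2) ∨
     (2 ≤ (i : ℕ) ∧ (i : ℕ) + 1 = (j : ℕ)) ∨ (2 ≤ (j : ℕ) ∧ (j : ℕ) + 1 = (i : ℕ))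
  then 1 else 0

def edgeE (n : ℕ) : Fin n → Fin n → ℕ := fun i j =>
  if ((i : ℕ) + 1 = (j : ℕ) ∧ (j : ℕ) ≤ n - 2) ∨ ((j : ℕ) + 1 = (i : ℕ) ∧ (i : ℕ) ≤ n - 2) ∨
     ((i : ℕ) = 2 ∧ (j : ℕ) = n - 1) ∨ ((j : ℕ) = 2 ∧ (i : ℕ) = n - 1)
  then 1 else 0

/-- The underlying graph (given by its edge-count function `E`) is a Dynkin diagram of
type `A`, `D`, or `E`. -/
def IsDynkinADE (n : ℕ) (E : Fin n → Fin n → ℕ) : Prop :=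
  ∃ e : Fin n ≃ Fin n,
    (∀ i j, E i j = edgeA n (e i) (e j)) ∨
    (4 ≤ n ∧ ∀ i j, E i j = edgeD n (e i) (e j)) ∨
    ((n = 6 ∨ n = 7 ∨ n = 8) ∧ ∀ i j, E i j = edgeE n (e i) (e j))

/-! ## Coxeter-sortable elements -/

/-- Lexicographic comparison of index tuples. -/
def lexLE {s : ℕ} (ι ι' : Fin s → ℕ) : Prop :=
  ι = ι' ∨ ∃ j, (∀ j', j' < j → ι j' = ι' j') ∧ ι j < ι' j

/-- `w` is `c`-sortable for the Coxeter element determined by the half-infinite word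
`cseq` (with dividers every `blockLen` letters): the lexicographically first subsequence
of `cseq` that is a reduced word for `w` defines a sequence of subsets (between adjacent
dividers) that is decreasing under inclusion. -/
def CSortable (A : Fin n → Fin n → ℤ) (hA : ∀ i, A i i = 2) (cseq : ℕ → Fin n)
    (blockLen : ℕ) (w : (Fin n → ℤ) ≃ₗ[ℤ] (Fin n → ℤ)) : Prop :=
  ∃ (s : ℕ) (ι : Fin s → ℕ), StrictMono ι ∧
    w = ((List.ofFn fun j => cseq (ι j)).map (sigmaE A hA)).prod ∧
    wordLen A hA w = s ∧
    (∀ ι' : Fin s → ℕ, StrictMono ι' →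
      w = ((List.ofFn fun j => cseq (ι' j)).map (sigmaE A hA)).prod → lexLE ι ι') ∧
    ∀ m : ℕ, {a : Fin n | ∃ j, (ι j) / blockLen = m + 1 ∧ cseq (ι j) = a} ⊆
             {a : Fin n | ∃ j, (ι j) / blockLen = m ∧ cseq (ι j) = a}


/-- A nonzero non-isomorphism between representations. -/
def RepStep {k : Type} [Field k] {n : ℕ} {Λ : Fin n → Fin n → ℕ} (X Y : Rep k n Λ) : Prop :=
  ∃ f : RepHom X Y, (∃ x v, f.g x v ≠ 0) ∧ ¬ ∀ x, Function.Bijective (f.g x)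

/-- `v` is a minimal element of `D` in the poset `(Γ₀, Λ)`. -/
def MinimalIn {n : ℕ} (Λ : Fin n → Fin n → ℕ) (D : Set (Fin n)) (v : Fin n) : Prop :=
  v ∈ D ∧ ∀ u ∈ D, PathLE Λ u v → u = v

/-- The pairs `(h, v)` of Proposition 3.2(a): `0 < h ≤ r` and `v` a minimal element of
`Supp S_h \ H_Λ(Supp S_{h+1})` (with `Supp S_{r+1} = ∅`). -/
def JoinPair {n : ℕ} (Λ : Fin n → Fin n → ℕ) (segs : List (List (Fin n)))
    (p : ℕ × Fin n) : Prop :=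
  0 < p.1 ∧ p.1 ≤ segs.length ∧
  MinimalIn Λ (suppOf (segs.getD (p.1 - 1) []) \ hull Λ (suppOf (segs.getD p.1 []))) p.2

/-! ## Auxiliary results: words, lengths and signs of roots -/

/-- The product of simple reflections along a list. -/
def pr {n : ℕ} (A : Fin n → Fin n → ℤ) (hA : ∀ i, A i i = 2) (l : List (Fin n)) :
    (Fin n → ℤ) ≃ₗ[ℤ] (Fin n → ℤ) := (l.map (sigmaE A hA)).prod

section words
variable {n : ℕ} {A : Fin n → Fin n → ℤ} {hA : ∀ i, A i i = 2}

lemma pr_nil : pr A hA [] = 1 := rfl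

lemma pr_cons (i : Fin n) (l : List (Fin n)) : pr A hA (i :: l) = sigmaE A hA i * pr A hA l := by
  simp [pr]

lemma pr_append (l l' : List (Fin n)) : pr A hA (l ++ l') = pr A hA l * pr A hA l' := by
  simp [pr]

lemma pr_single (i : Fin n) : pr A hA [i] = sigmaE A hA i := by simp [pr]

lemma sig_apply (i : Fin n) (v : Fin n → ℤ) :
    sigmaE A hA i v = v - (∑ l, A i l * v l) • Pi.single i 1 := rfl

lemma sig_sq (i : Fin n) : sigmaE A hA i * sigmaE A hA i = 1 := by
  apply LinearEquiv.toLinearMap_injective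
  exact sigma_invol A hA i

lemma sig_single (i j : Fin n) :
    sigmaE A hA i (Pi.single j 1) = Pi.single j 1 - A i j • Pi.single i 1 := by
  rw [sig_apply]
  congr 2
  simp [Pi.single_apply]

lemma sig_self (i : Fin n) : sigmaE A hA i (Pi.single i 1) = - Pi.single i 1 := by
  rw [sig_single, hA, two_smul]; abel

lemma sig_ne {i j : Fin n} (h : j ≠ i) (v : Fin n → ℤ) : sigmaE A hA i v j = v j := by
  rw [sig_apply]; simp [h]

lemma det_sig (i : Fin n) : LinearMap.det (sigmaE A hA i : (Fin n → ℤ) →ₗ[ℤ] (Fin n → ℤ)) = -1 := by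
  have : (sigmaE A hA i : (Fin n → ℤ) →ₗ[ℤ] (Fin n → ℤ)) =
      LinearMap.transvection (∑ l, A i l • LinearMap.proj l : (Fin n → ℤ) →ₗ[ℤ] ℤ)
        (- Pi.single i 1) := by
    ext j k
    simp [sig_apply, LinearMap.transvection.apply, Pi.single_apply, sub_eq_add_neg]
  rw [this, LinearMap.transvection.det]
  simp [hA, Pi.single_apply]

lemma det_pr (l : List (Fin n)) :
    LinearMap.det (pr A hA l : (Fin n → ℤ) →ₗ[ℤ] (Fin n → ℤ)) = (-1) ^ l.length := by
  induction l with
  | nil => simp [pr_nil]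
  | cons i l ih =>
    rw [pr_cons, List.length_cons, pow_succ', ← ih, ← det_sig (A := A) (hA := hA) i,
      ← LinearMap.det_comp]
    rfl

lemma parity {l l' : List (Fin n)} (h : pr A hA l = pr A hA l') :
    (-1 : ℤ) ^ l.length = (-1) ^ l'.length := by
  rw [← det_pr (A := A) (hA := hA), ← det_pr (A := A) (hA := hA), h]

lemma len_le (l : List (Fin n)) : wordLen A hA (pr A hA l) ≤ l.length :=
  Nat.sInf_le ⟨l, rfl, rfl⟩

/-- The element is a product of simple reflections. -/
def IsW (A : Fin n → Fin n → ℤ) (hA : ∀ i, A i i = 2) (g : (Fin n → ℤ) ≃ₗ[ℤ] (Fin n → ℤ)) : Prop :=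
  ∃ l, g = pr A hA l

lemma exists_red {g : (Fin n → ℤ) ≃ₗ[ℤ] (Fin n → ℤ)} (hg : IsW A hA g) :
    ∃ l : List (Fin n), l.length = wordLen A hA g ∧ g = pr A hA l := by
  obtain ⟨l, hl⟩ := hg
  have := Nat.sInf_mem (s := {l | ∃ ys : List (Fin n), ys.length = l ∧ g = (ys.map (sigmaE A hA)).prod})
    ⟨l.length, l, rfl, hl⟩
  obtain ⟨ys, h1, h2⟩ := this
  exact ⟨ys, h1, h2⟩

lemma IsW.mul {g h : (Fin n → ℤ) ≃ₗ[ℤ] (Fin n → ℤ)} (hg : IsW A hA g) (hh : IsW A hA h) :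
    IsW A hA (g * h) := by
  obtain ⟨l, rfl⟩ := hg
  obtain ⟨l', rfl⟩ := hh
  exact ⟨l ++ l', (pr_append _ _).symm⟩

lemma isW_sig (i : Fin n) : IsW A hA (sigmaE A hA i) := ⟨[i], (pr_single i).symm⟩

lemma len_mul_pr {g : (Fin n → ℤ) ≃ₗ[ℤ] (Fin n → ℤ)} (hg : IsW A hA g) (l : List (Fin n)) :
    wordLen A hA (g * pr A hA l) ≤ wordLen A hA g + l.length := by
  obtain ⟨y, h1, h2⟩ := exists_red hg
  have := len_le (A := A) (hA := hA) (y ++ l)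
  rw [pr_append, ← h2, List.length_append, h1] at this
  exact this

lemma len_mul_sig {g : (Fin n → ℤ) ≃ₗ[ℤ] (Fin n → ℤ)} (hg : IsW A hA g) (i : Fin n) :
    wordLen A hA (g * sigmaE A hA i) = wordLen A hA g + 1 ∨
    wordLen A hA (g * sigmaE A hA i) + 1 = wordLen A hA g := by
  have h1 := len_mul_pr hg [i]
  rw [pr_single] at h1
  have hg' := hg.mul (isW_sig i)
  have h2 := len_mul_pr hg' [i]
  rw [pr_single, mul_assoc, sig_sq, mul_one] at h2
  have h3 : wordLen A hA (g * sigmaE A hA i) ≠ wordLen A hA g := by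
    intro h
    obtain ⟨y, hy1, hy2⟩ := exists_red hg
    obtain ⟨z, hz1, hz2⟩ := exists_red hg'
    have : pr A hA z = pr A hA (y ++ [i]) := by rw [← hz2, pr_append, ← hy2, pr_single]
    have := parity this
    rw [hz1, h, List.length_append, hy1, List.length_singleton, pow_succ] at this
    have h0 : ((-1 : ℤ)) ^ (wordLen A hA g) ≠ 0 := by simp
    omega
  simp only [List.length_singleton] at h1 h2
  omega

lemma phi_sub (i j : Fin n) (w : Fin n → ℤ) (c : ℤ) :
    ∑ l, A i l * (w - c • (Pi.single j 1 : Fin n → ℤ)) l = (∑ l, A i l * w l) - c * A i j := by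
  simp [mul_sub, Finset.sum_sub_distrib, Pi.single_apply]
  ring

lemma sig_comm {x y : Fin n} (h : A x y = 0) (h' : A y x = 0) :
    sigmaE A hA x * sigmaE A hA y = sigmaE A hA y * sigmaE A hA x := by
  ext1 w
  simp only [LinearEquiv.mul_apply, sig_apply, phi_sub, h, h']
  module

lemma sig_braid {x y : Fin n} (h : A x y = -1) (h' : A y x = -1) :
    sigmaE A hA x * sigmaE A hA y * sigmaE A hA x =
      sigmaE A hA y * sigmaE A hA x * sigmaE A hA y := by
  ext1 w
  simp only [LinearEquiv.mul_apply, sig_apply, phi_sub, h, h', hA]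
  module

lemma dihedral_big {i j : Fin n} (haij : A i j ≤ -2) (haji : A j i ≤ -2) :
    ∀ (v : List (Fin n)) (t : Fin n), (∀ x ∈ v ++ [t], x = i ∨ x = j) →
      List.IsChain (· ≠ ·) (v ++ [t]) → ∀ h r, v ++ [t] = h :: r →
      ∃ (x y : ℤ) (h' : Fin n), 0 ≤ y ∧ y ≤ x ∧ (h' = i ∨ h' = j) ∧ h' ≠ h ∧ 
        pr A hA v (Pi.single t 1) = x • Pi.single h 1 + y • Pi.single h' 1 := by
  have hij : i ≠ j := by
    rintro rfl
    rw [hA] at haij; omega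
  intro v
  induction v with
  | nil =>
    intro t hm _ h r e
    simp only [List.nil_append, List.cons.injEq] at e
    obtain ⟨rfl, -⟩ := e
    rcases hm t (by simp) with rfl | rfl
    · exact ⟨1, 0, j, by simp, by simp, by simp, hij.symm, by simp [pr_nil]⟩
    · exact ⟨1, 0, i, by simp, by simp, by simp, hij, by simp [pr_nil]⟩
  | cons h0 v ih =>
    intro t hm hc h r e
    simp only [List.cons_append, List.cons.injEq] at e hm hc
    obtain ⟨rfl, rfl⟩ := e
    obtain ⟨h2, r2, e2⟩ : ∃ h2 r2, v ++ [t] = h2 :: r2 := by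
      cases v with
      | nil => exact ⟨_, _, rfl⟩
      | cons a b => exact ⟨_, _, rfl⟩
    obtain ⟨x, y, h', hy, hxy, hh', hne, hp⟩ :=
      ih t (fun x hx => hm x (List.mem_cons_of_mem _ hx)) hc.tail h2 r2 e2
    have hne2 : h0 ≠ h2 := by
      rw [e2] at hc
      exact (List.isChain_cons_cons.1 hc).1
    have h0m := hm h0 (by simp)
    have h2m := hm h2 (by rw [e2]; simp)
    have hh : h' = h0 := by grind
    subst hh
    have hA2 : A h' h2 ≤ -2 := by grind
    refine ⟨- A h' h2 * x - y, x, h2, by omega, by nlinarith, h2m, hne2.symm, ?_⟩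
    rw [pr_cons, LinearEquiv.mul_apply, hp, map_add, map_zsmul, map_zsmul, sig_single, sig_self]
    module

lemma dihedral (hsym : ∀ i j, A i j = A j i) (hoff : ∀ i j, i ≠ j → A i j ≤ 0)
    {i j : Fin n} (hij : i ≠ j) (v : List (Fin n)) (t : Fin n)
    (hm : ∀ x ∈ v ++ [t], x = i ∨ x = j)
    (hmin : ∀ v', pr A hA v' = pr A hA (v ++ [t]) → (v ++ [t]).length ≤ v'.length) :
    ∃ x y : ℤ, 0 ≤ x ∧ 0 ≤ y ∧ 
      pr A hA v (Pi.single t 1) = x • Pi.single i 1 + y • Pi.single j 1 := by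
  have hchain : List.IsChain (· ≠ ·) (v ++ [t]) := by
    rw [List.isChain_iff_forall_rel_of_append_cons_cons]
    rintro a b l1 l2 e rfl
    have := hmin (l1 ++ l2) (by
      rw [e, pr_append, pr_append, pr_cons, pr_cons, ← mul_assoc (sigmaE A hA a), sig_sq, one_mul])
    rw [e] at this
    simp at this
  by_cases h2 : A i j ≤ -2
  · obtain ⟨h, r, e⟩ : ∃ h r, v ++ [t] = h :: r := by
      cases v with
      | nil => exact ⟨_, _, rfl⟩
      | cons a b => exact ⟨_, _, rfl⟩
    obtain ⟨x, y, h', hy, hxy, hh', hne, hp⟩ :=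
      dihedral_big (hA := hA) h2 (by rw [hsym]; exact h2) v t hm hchain h r e
    have hhm := hm h (by rw [e]; simp)
    rcases hhm with rfl | rfl
    · rcases hh' with rfl | rfl
      · exact absurd rfl hne
      · exact ⟨x, y, by omega, hy, hp⟩
    · rcases hh' with rfl | rfl
      · exact ⟨y, x, hy, by omega, by rw [hp, add_comm]⟩
      · exact absurd rfl hne
  · have hle := hoff i j hij
    -- symmetric facts
    have key : ∀ x y : Fin n, (x = i ∨ x = j) → (y = i ∨ y = j) → x ≠ y → A x y = A i j := by
      intro x y hx hy hxy
      have := hsym i j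
      grind
    obtain h0 | h1 : A i j = 0 ∨ A i j = -1 := by omega
    · rcases v with _ | ⟨a, _ | ⟨b, v⟩⟩
      · rcases hm t (by simp) with rfl | rfl
        · exact ⟨1, 0, by simp, by simp, by simp [pr_nil]⟩
        · exact ⟨0, 1, by simp, by simp, by simp [pr_nil]⟩
      · have hat : a ≠ t := by
          simpa using hchain
        have hk := key a t (hm _ (by simp)) (hm _ (by simp)) hat
        have e : pr A hA [a] (Pi.single t 1) = Pi.single t 1 := by
          rw [pr_single, sig_single, hk, h0]; simp
        rw [e]
        rcases hm t (by simp) with rfl | rfl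
        · exact ⟨1, 0, by simp, by simp, by simp⟩
        · exact ⟨0, 1, by simp, by simp, by simp⟩
      · exfalso
        obtain ⟨c, r, e⟩ : ∃ c r, v ++ [t] = c :: r := by
          cases v with
          | nil => exact ⟨_, _, rfl⟩
          | cons a b => exact ⟨_, _, rfl⟩
        simp only [List.cons_append, e] at hm hmin hchain
        simp only [List.isChain_cons_cons] at hchain
        have hca : c = a := by
          have := hm a (by simp); have := hm b (by simp); have := hm c (by simp); grind
        subst hca
        have hk := key c b (hm _ (by simp)) (hm _ (by simp)) hchain.1
        have hk' := key b c (hm _ (by simp)) (hm _ (by simp)) hchain.1.symm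
        have := hmin (b :: r) (by
          rw [pr_cons, pr_cons, pr_cons, pr_cons, ← mul_assoc (sigmaE A hA b),
            sig_comm (by rw [hk', h0]) (by rw [hk, h0]), mul_assoc, ← mul_assoc (sigmaE A hA c),
            sig_sq, one_mul])
        simp at this
    · rcases v with _ | ⟨a, _ | ⟨b, _ | ⟨c, v⟩⟩⟩
      · rcases hm t (by simp) with rfl | rfl
        · exact ⟨1, 0, by simp, by simp, by simp [pr_nil]⟩
        · exact ⟨0, 1, by simp, by simp, by simp [pr_nil]⟩
      · have hat : a ≠ t := by
          simpa using hchain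
        have hk := key a t (hm _ (by simp)) (hm _ (by simp)) hat
        have e : pr A hA [a] (Pi.single t 1) = Pi.single t 1 + Pi.single a 1 := by
          rw [pr_single, sig_single, hk, h1]; simp
        rw [e]
        have hta : (t = i ∧ a = j) ∨ (t = j ∧ a = i) := by
          have := hm t (by simp); have := hm a (by simp); grind
        rcases hta with ⟨rfl, rfl⟩ | ⟨rfl, rfl⟩
        · exact ⟨1, 1, by simp, by simp, by simp⟩
        · exact ⟨1, 1, by simp, by simp, by simp [add_comm]⟩
      · simp only [List.cons_append, List.nil_append, List.isChain_cons_cons] at hchain hm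
        have hta : t = a := by
          have := hm t (by simp); have := hm a (by simp); have := hm b (by simp); grind
        subst hta
        have hk := key t b (hm _ (by simp)) (hm _ (by simp)) hchain.1
        have hk' := key b t (hm _ (by simp)) (hm _ (by simp)) hchain.1.symm
        have e : pr A hA [t, b] (Pi.single t 1) = Pi.single b 1 := by
          rw [pr_cons, pr_single, LinearEquiv.mul_apply, sig_single, map_sub, map_zsmul, sig_self,
            sig_single, hk, hk', h1]
          simp
        rw [e]
        rcases hm b (by simp) with rfl | rfl
        · exact ⟨1, 0, by simp, by simp, by simp⟩
        · exact ⟨0, 1, by simp, by simp, by simp⟩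
      · exfalso
        obtain ⟨d, r, e⟩ : ∃ c r, v ++ [t] = c :: r := by
          cases v with
          | nil => exact ⟨_, _, rfl⟩
          | cons a b => exact ⟨_, _, rfl⟩
        simp only [List.cons_append, e] at hm hmin hchain
        simp only [List.isChain_cons_cons] at hchain
        have hca : c = a ∧ d = b := by
          have := hm a (by simp); have := hm b (by simp); have := hm c (by simp)
          have := hm d (by simp); grind
        obtain ⟨rfl, rfl⟩ := hca
        have hk := key c d (hm _ (by simp)) (hm _ (by simp)) hchain.1
        have hk' := key d c (hm _ (by simp)) (hm _ (by simp)) hchain.1.symm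
        have := hmin (d :: c :: r) (by
          rw [pr_cons, pr_cons, pr_cons, pr_cons, pr_cons, pr_cons]
          have hb := sig_braid (hA := hA) (by rw [hk, h1]) (by rw [hk', h1])
          calc sigmaE A hA d * (sigmaE A hA c * pr A hA r)
              = sigmaE A hA d * sigmaE A hA c * (sigmaE A hA d * sigmaE A hA d) * pr A hA r := by
                rw [sig_sq, mul_one, mul_assoc]
            _ = (sigmaE A hA d * sigmaE A hA c * sigmaE A hA d) * sigmaE A hA d * pr A hA r := by
                simp only [mul_assoc]
            _ = _ := by rw [← hb]; simp only [mul_assoc])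
        simp at this

end words
section deodhar
variable {n : ℕ} {A : Fin n → Fin n → ℤ} {hA : ∀ i, A i i = 2}

lemma apply_nonneg_of_len (hsym : ∀ i j, A i j = A j i) (hoff : ∀ i j, i ≠ j → A i j ≤ 0) :
    ∀ (N : ℕ) (g : (Fin n → ℤ) ≃ₗ[ℤ] (Fin n → ℤ)), IsW A hA g → wordLen A hA g = N →
      ∀ i, wordLen A hA g < wordLen A hA (g * sigmaE A hA i) → 0 ≤ g (Pi.single i 1) := by
  intro N
  induction N using Nat.strong_induction_on with
  | _ N ih =>
  intro g hg hN i hi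
  obtain ⟨y, hy1, hy2⟩ := exists_red hg
  rcases List.eq_nil_or_concat y with rfl | ⟨y, j, rfl⟩
  · rw [hy2, pr_nil]
    simp
  rw [List.concat_eq_append] at hy1 hy2
  have hgj : g * sigmaE A hA j = pr A hA y := by
    rw [hy2, pr_append, pr_single, mul_assoc, sig_sq, mul_one]
  have hlj : wordLen A hA (g * sigmaE A hA j) + 1 = wordLen A hA g := by
    have h1 := len_le (A := A) (hA := hA) y
    rw [← hgj] at h1
    have := len_mul_sig hg j
    simp at hy1
    omega
  have hij : i ≠ j := by
    rintro rfl
    omega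
  -- minimal decomposition
  let P : ℕ → Prop := fun k => ∃ (u : (Fin n → ℤ) ≃ₗ[ℤ] (Fin n → ℤ)) (v : List (Fin n)),
    IsW A hA u ∧ wordLen A hA u = k ∧ (∀ x ∈ v, x = i ∨ x = j) ∧ g = u * pr A hA v ∧
      wordLen A hA g = wordLen A hA u + v.length
  have hP0 : P (wordLen A hA (g * sigmaE A hA j)) :=
    ⟨g * sigmaE A hA j, [j], hg.mul (isW_sig j), rfl, by simp, by
      rw [pr_single, mul_assoc, sig_sq, mul_one], by simp; omega⟩
  have hP : ∃ k, P k := ⟨_, hP0⟩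
  classical
  obtain ⟨u, v, hu, huk, hv, hguv, hlen⟩ := Nat.find_spec hP
  have hlt : wordLen A hA u < N := by
    have := Nat.find_min' hP hP0
    omega
  have hup : ∀ t, (t = i ∨ t = j) → wordLen A hA u < wordLen A hA (u * sigmaE A hA t) := by
    intro t ht
    by_contra hcon
    have h2 := len_mul_sig hu t
    have h3 : P (wordLen A hA (u * sigmaE A hA t)) := by
      refine ⟨u * sigmaE A hA t, t :: v, hu.mul (isW_sig t), rfl, ?_, ?_, ?_⟩
      · intro x hx
        rcases List.mem_cons.1 hx with rfl | hx
        · exact ht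
        · exact hv x hx
      · rw [pr_cons, mul_assoc, ← mul_assoc (sigmaE A hA t), sig_sq, one_mul, hguv]
      · simp; omega
    have := Nat.find_min' hP h3
    omega
  have hui := ih _ hlt u hu rfl i (hup i (Or.inl rfl))
  have huj := ih _ hlt u hu rfl j (hup j (Or.inr rfl))
  obtain ⟨x, y, hx, hy, hxy⟩ := dihedral (hA := hA) hsym hoff hij v i (by
    intro x hx
    rcases List.mem_append.1 hx with hx | hx
    · exact hv x hx
    · left; simpa using hx) (by
    intro v' hv'
    have h1 := len_mul_pr hu v'
    rw [hv', pr_append, ← mul_assoc, ← hguv, pr_single] at h1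
    simp
    omega)
  rw [hguv, LinearEquiv.mul_apply, hxy, map_add, map_zsmul, map_zsmul]
  exact add_nonneg (zsmul_nonneg hui hx) (zsmul_nonneg huj hy)

lemma apply_nonpos_of_len (hsym : ∀ i j, A i j = A j i) (hoff : ∀ i j, i ≠ j → A i j ≤ 0)
    {g : (Fin n → ℤ) ≃ₗ[ℤ] (Fin n → ℤ)} (hg : IsW A hA g) (i : Fin n)
    (h : wordLen A hA (g * sigmaE A hA i) < wordLen A hA g) : g (Pi.single i 1) ≤ 0 := by
  have := apply_nonneg_of_len hsym hoff _ (g * sigmaE A hA i) (hg.mul (isW_sig i)) rfl i (by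
    rwa [mul_assoc, sig_sq, mul_one])
  rw [LinearEquiv.mul_apply, sig_self, map_neg] at this
  exact neg_nonneg.1 this

lemma root_sign (hsym : ∀ i j, A i j = A j i) (hoff : ∀ i j, i ≠ j → A i j ≤ 0)
    {g : (Fin n → ℤ) ≃ₗ[ℤ] (Fin n → ℤ)} (hg : IsW A hA g) (i : Fin n) :
    0 ≤ g (Pi.single i 1) ∨ g (Pi.single i 1) ≤ 0 := by
  rcases len_mul_sig hg i with h | h
  · exact Or.inl (apply_nonneg_of_len hsym hoff _ g hg rfl i (by omega))
  · exact Or.inr (apply_nonpos_of_len hsym hoff hg i (by omega))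

/-- All inversion roots of the word are nonnegative. -/
def Good (A : Fin n → Fin n → ℤ) (hA : ∀ i, A i i = 2) (l : List (Fin n)) : Prop :=
  ∀ l1 j l2, l = l1 ++ j :: l2 → 0 ≤ pr A hA l1 (Pi.single j 1)

lemma Good.front {l : List (Fin n)} {i : Fin n} (h : Good A hA (l ++ [i])) : Good A hA l := by
  rintro l1 j l2 rfl
  exact h l1 j (l2 ++ [i]) (by simp)

lemma len_of_good (hsym : ∀ i j, A i j = A j i) (hoff : ∀ i j, i ≠ j → A i j ≤ 0)
    (l : List (Fin n)) (h : Good A hA l) : wordLen A hA (pr A hA l) = l.length := by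
  induction l using List.reverseRecOn with
  | nil => have := len_le (A := A) (hA := hA) []; simpa using this
  | append_singleton l i ih =>
    have h1 := ih h.front
    have hW : IsW A hA (pr A hA l) := ⟨l, rfl⟩
    rw [pr_append, pr_single]
    rcases len_mul_sig hW i with h2 | h2
    · rw [h2, h1]; simp
    · exfalso
      have h3 := apply_nonpos_of_len hsym hoff hW i (by omega)
      have h4 := h l i [] rfl
      have h5 := le_antisymm h3 h4
      have h6 : (Pi.single i 1 : Fin n → ℤ) = 0 := (pr A hA l).map_eq_zero_iff.1 h5
      have := congrFun h6 i
      simp at this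

/-- The quadratic form. -/
def qf (A : Fin n → Fin n → ℤ) (v : Fin n → ℤ) : ℤ := ∑ i, v i * ∑ j, A i j * v j

lemma qf_sig (hsym : ∀ i j, A i j = A j i) (i : Fin n) (v : Fin n → ℤ) :
    qf A (sigmaE A hA i v) = qf A v := by
  unfold qf
  rw [sig_apply]
  simp only [phi_sub]
  set c := ∑ l, A i l * v l with hc
  have : ∑ x, v x * A x i = c := by
    rw [hc]; exact Finset.sum_congr rfl fun x _ => by rw [hsym, mul_comm]
  have h2 : ∑ x, v x * (c * A x i) = c * c := by
    calc ∑ x, v x * (c * A x i) = c * ∑ x, v x * A x i := by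
          rw [Finset.mul_sum]
          exact Finset.sum_congr rfl fun x _ => by ring
      _ = c * c := by rw [this]
  simp only [Pi.sub_apply, Pi.smul_apply, smul_eq_mul, sub_mul, mul_sub, Finset.sum_sub_distrib, h2]
  simp [Pi.single_apply, hA, ← hc]
  ring

lemma qf_pr (hsym : ∀ i j, A i j = A j i) (l : List (Fin n)) (v : Fin n → ℤ) :
    qf A (pr A hA l v) = qf A v := by
  induction l with
  | nil => rfl
  | cons i l ih => rw [pr_cons, LinearEquiv.mul_apply, qf_sig hsym, ih]

lemma qf_single (hA : ∀ i, A i i = 2) (i : Fin n) (c : ℤ) : qf A (Pi.single i c) = 2 * c * c := by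
  simp [qf, Pi.single_apply, hA]; ring

lemma exists_of_neg (hsym : ∀ i j, A i j = A j i) (hoff : ∀ i j, i ≠ j → A i j ≤ 0)
    (l : List (Fin n)) (i : Fin n) (h : ¬ 0 ≤ pr A hA l (Pi.single i 1)) :
    ∃ l1 j l2, l = l1 ++ j :: l2 ∧ pr A hA l2 (Pi.single i 1) = Pi.single j 1 := by
  induction l with
  | nil => 
    exfalso; apply h; simp [pr_nil]
  | cons j l ih =>
    by_cases h0 : 0 ≤ pr A hA l (Pi.single i 1)
    · refine ⟨[], j, l, rfl, ?_⟩
      have h1 := (root_sign hsym hoff ⟨j :: l, rfl⟩ i).resolve_left h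
      rw [pr_cons, LinearEquiv.mul_apply] at h1
      have hq := qf_pr (hA := hA) hsym l (Pi.single i 1)
      set γ := pr A hA l (Pi.single i 1) with hγ
      have hγ' : γ = Pi.single j (γ j) := by
        ext p
        by_cases hp : p = j
        · subst hp; simp
        · have h2 := h1 p
          rw [sig_ne hp] at h2
          have h3 := h0 p
          simp only [Pi.single_eq_of_ne hp]
          exact le_antisymm h2 h3
      rw [hγ', qf_single hA, qf_single hA] at hq
      have h3 : 0 ≤ γ j := h0 j
      have : γ j = 1 := by nlinarith
      rw [hγ', this]
    · obtain ⟨l1, k, l2, rfl, h2⟩ := ih h0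
      exact ⟨j :: l1, k, l2, rfl, h2⟩

end deodhar
section realside
variable {n : ℕ} {A : Fin n → Fin n → ℤ} {hA : ∀ i, A i i = 2}

/-- The simple reflection acting on real vectors. -/
def sR (A : Fin n → Fin n → ℤ) (i : Fin n) (d : Fin n → ℝ) : Fin n → ℝ :=
  d - (∑ l, (A i l : ℝ) * d l) • (Pi.single i 1 : Fin n → ℝ)

/-- Action of a word on real vectors. -/
def act (A : Fin n → Fin n → ℤ) (l : List (Fin n)) (d : Fin n → ℝ) : Fin n → ℝ :=
  l.foldr (sR A) d

/-- Coordinatewise cast. -/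
def cst (v : Fin n → ℤ) : Fin n → ℝ := fun p => (v p : ℝ)

lemma cst_sig (i : Fin n) (v : Fin n → ℤ) : cst (sigmaE A hA i v) = sR A i (cst v) := by
  ext p
  simp [cst, sR, sig_apply, Pi.single_apply]

lemma cst_single (i : Fin n) : cst (Pi.single i 1 : Fin n → ℤ) = Pi.single i 1 := by
  ext p
  simp [cst, Pi.single_apply]

lemma cst_pr (l : List (Fin n)) (v : Fin n → ℤ) : cst (pr A hA l v) = act A l (cst v) := by
  induction l with
  | nil => rfl
  | cons i l ih => rw [pr_cons, LinearEquiv.mul_apply, cst_sig, ih]; rfl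

lemma act_append (l l' : List (Fin n)) (d : Fin n → ℝ) :
    act A (l ++ l') d = act A l (act A l' d) := by
  simp [act]

/-- The symmetric bilinear form. -/
def Bf (A : Fin n → Fin n → ℤ) (a b : Fin n → ℝ) : ℝ := ∑ i, a i * ∑ j, (A i j : ℝ) * b j

lemma phiR_sub (i j : Fin n) (w : Fin n → ℝ) (c : ℝ) :
    ∑ l, (A i l : ℝ) * (w - c • (Pi.single j 1 : Fin n → ℝ)) l =
      (∑ l, (A i l : ℝ) * w l) - c * A i j := by
  simp [mul_sub, Finset.sum_sub_distrib, Pi.single_apply]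
  ring

lemma Bf_sR (hsym : ∀ i j, A i j = A j i) (i : Fin n) (a b : Fin n → ℝ) :
    Bf A (sR A i a) b = Bf A a (sR A i b) := by
  unfold Bf sR
  simp only [phiR_sub]
  set c := ∑ l, (A i l : ℝ) * b l with hc
  have h2 : ∑ x, a x * (c * (A x i : ℝ)) = c * ∑ l, (A i l : ℝ) * a l := by
    rw [Finset.mul_sum]
    exact Finset.sum_congr rfl fun x _ => by rw [hsym x i]; ring
  simp only [Pi.sub_apply, Pi.smul_apply, smul_eq_mul, sub_mul, mul_sub, Finset.sum_sub_distrib, h2]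
  simp [Pi.single_apply, ← hc]
  ring

lemma Bf_act (hsym : ∀ i j, A i j = A j i) (l : List (Fin n)) (a b : Fin n → ℝ) :
    Bf A (act A l a) b = Bf A a (act A l.reverse b) := by
  induction l generalizing b with
  | nil => rfl
  | cons i l ih =>
    rw [List.reverse_cons, act_append]
    change Bf A (sR A i (act A l a)) b = _
    rw [Bf_sR hsym, ih]
    rfl

lemma Bf_single (j : Fin n) (b : Fin n → ℝ) :
    Bf A (Pi.single j 1) b = ∑ l, (A j l : ℝ) * b l := by
  simp [Bf, Pi.single_apply]

lemma grow (hsym : ∀ i j, A i j = A j i) {δ : Fin n → ℝ}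
    (hδ : ∀ i, ∑ j, (A i j : ℝ) * δ j ≤ 0) (l : List (Fin n)) (h : Good A hA l) (p : Fin n) :
    δ p ≤ act A l.reverse δ p := by
  induction l using List.reverseRecOn with
  | nil => exact le_rfl
  | append_singleton l i ih =>
    have h1 := ih h.front
    rw [List.reverse_append, act_append]
    refine h1.trans ?_
    change _ ≤ sR A i (act A l.reverse δ) p
    have h2 : ∑ k, (A i k : ℝ) * (act A l.reverse δ) k ≤ 0 := by
      rw [← Bf_single, ← Bf_act hsym, ← cst_single, ← cst_pr (hA := hA)]
      unfold Bf
      apply Finset.sum_nonpos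
      intro k _
      apply mul_nonpos_of_nonneg_of_nonpos _ (hδ k)
      have := h l i [] rfl k
      simp only [cst]
      exact_mod_cast this
    simp only [sR, Pi.sub_apply, Pi.smul_apply, smul_eq_mul, Pi.single_apply]
    split_ifs <;> linarith

/-- The Euler form attached to an ordering of the vertices. -/
def Ef (A : Fin n → Fin n → ℤ) : List (Fin n) → (Fin n → ℝ) → (Fin n → ℝ) → ℝ
  | [], _, _ => 0
  | i :: p, a, b => Ef A p a b + a i * b i + (p.map fun k => (A i k : ℝ) * a k).sum * b i

lemma Ef_snoc (hsym : ∀ i j, A i j = A j i) (p : List (Fin n)) (i : Fin n) (a b : Fin n → ℝ) :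
    Ef A (p ++ [i]) a b = Ef A p a b + a i * b i + a i * (p.map fun k => (A i k : ℝ) * b k).sum := by
  induction p with
  | nil => simp [Ef]
  | cons h p ih =>
    simp only [List.cons_append, Ef, ih, List.map_append, List.sum_append, List.map_cons,
      List.sum_cons, List.map_nil, List.sum_nil, hsym h i]
    ring

lemma Ef_congr (p : List (Fin n)) {a a' b b' : Fin n → ℝ} (ha : ∀ k ∈ p, a k = a' k)
    (hb : ∀ k ∈ p, b k = b' k) : Ef A p a b = Ef A p a' b' := by
  induction p with
  | nil => rfl
  | cons h p ih =>
    simp only [Ef]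
    rw [ih (fun k hk => ha k (List.mem_cons_of_mem _ hk)) (fun k hk => hb k (List.mem_cons_of_mem _ hk)),
      ha h (by simp), hb h (by simp)]
    congr 2
    congr 1
    apply List.map_congr_left
    intro k hk
    rw [ha k (List.mem_cons_of_mem _ hk)]

lemma Ef_zero (p : List (Fin n)) (b : Fin n → ℝ) : Ef A p 0 b = 0 := by
  induction p with
  | nil => rfl
  | cons h p ih => simp [Ef, ih]

lemma sum_eq_list {i : Fin n} {p : List (Fin n)} (hnd : (i :: p).Nodup) (hall : ∀ k, k ∈ i :: p)
    (f : Fin n → ℝ) : ∑ k, f k = f i + (p.map f).sum := by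
  have h1 : (Finset.univ : Finset (Fin n)) = (i :: p).toFinset := by
    ext k; simpa using hall k
  rw [h1, List.sum_toFinset f hnd]
  simp

lemma sR_ne {i k : Fin n} (h : k ≠ i) (d : Fin n → ℝ) : sR A i d k = d k := by
  simp [sR, h]

lemma Ef_step (hsym : ∀ i j, A i j = A j i) (hA : ∀ i, A i i = 2)
    {i : Fin n} {p : List (Fin n)} (hnd : (i :: p).Nodup)
    (hall : ∀ k, k ∈ i :: p) (a d : Fin n → ℝ) :
    Ef A (i :: p) (sR A i a) d = Ef A (p ++ [i]) a (sR A i d) := by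
  have hi : i ∉ p := (List.nodup_cons.1 hnd).1
  have hk : ∀ k ∈ p, k ≠ i := fun k hk e => hi (e ▸ hk)
  rw [Ef_snoc hsym]
  simp only [Ef]
  have h1 : Ef A p (sR A i a) d = Ef A p a (sR A i d) :=
    Ef_congr p (fun k h => sR_ne (hk k h) a) (fun k h => (sR_ne (hk k h) d).symm)
  have h2 : (p.map fun k => (A i k : ℝ) * sR A i a k) = p.map fun k => (A i k : ℝ) * a k :=
    List.map_congr_left fun k h => by rw [sR_ne (hk k h)]
  have h3 : (p.map fun k => (A i k : ℝ) * sR A i d k) = p.map fun k => (A i k : ℝ) * d k :=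
    List.map_congr_left fun k h => by rw [sR_ne (hk k h)]
  rw [h1, h2, h3]
  have h4 : ∀ w : Fin n → ℝ, sR A i w i = - w i - (p.map fun k => (A i k : ℝ) * w k).sum := by
    intro w
    simp only [sR, Pi.sub_apply, Pi.smul_apply, smul_eq_mul, Pi.single_eq_same, mul_one]
    rw [sum_eq_list hnd hall, hA]
    push_cast
    ring
  rw [h4, h4]
  ring

/-- The first `k` letters of the periodic word with period `p`. -/
def word : ℕ → List (Fin n) → List (Fin n)
  | 0, _ => []
  | _ + 1, [] => []
  | k + 1, i :: p => i :: word k (p ++ [i])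

lemma Ef_word (hsym : ∀ i j, A i j = A j i) (hA : ∀ i, A i i = 2) :
    ∀ (k : ℕ) (p : List (Fin n)) (δ : Fin n → ℝ) (l : List (Fin n)) (i : Fin n),
      p.Nodup → (∀ k, k ∈ p) → word (k + 1) p = l ++ [i] →
      Ef A p (act A l (Pi.single i 1)) δ = act A l.reverse δ i := by
  intro k
  induction k with
  | zero =>
    intro p δ l i hnd hall hw
    rcases p with _ | ⟨h, p⟩
    · simp [word] at hw
    · simp only [word] at hw
      have hl : l = [] ∧ h = i := by
        rcases l with _ | ⟨x, l⟩
        · simpa using hw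
        · simp at hw
      obtain ⟨rfl, rfl⟩ := hl
      have hi : h ∉ p := (List.nodup_cons.1 hnd).1
      have hk : ∀ k ∈ p, (Pi.single h 1 : Fin n → ℝ) k = (0 : Fin n → ℝ) k := fun k hk => by
        have : k ≠ h := fun e => hi (e ▸ hk)
        simp [this]
      have h0 : Ef A p (Pi.single h 1) δ = 0 := by
        rw [Ef_congr p hk (fun _ _ => rfl), Ef_zero]
      have h2 : (p.map fun k => (A h k : ℝ) * (Pi.single h 1 : Fin n → ℝ) k) = p.map fun k => (0 : ℝ) :=
        List.map_congr_left fun k hk' => by rw [hk k hk']; simp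
      change Ef A (h :: p) (Pi.single h 1) δ = δ h
      simp only [Ef]
      rw [h0, h2]
      simp
  | succ k ih =>
    intro p δ l i hnd hall hw
    rcases p with _ | ⟨h, p⟩
    · simp [word] at hw
    · rw [word] at hw
      rcases l with _ | ⟨x, l⟩
      · exfalso
        rcases p with _ | ⟨h', p⟩ <;> simp [word] at hw
      · simp only [List.cons_append, List.cons.injEq] at hw
        obtain ⟨rfl, hw⟩ := hw
        change Ef A (h :: p) (sR A h (act A l _)) δ = _
        rw [Ef_step hsym hA hnd hall, ih (p ++ [h]) _ l i
          ((List.perm_append_singleton h p).nodup_iff.2 hnd)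
          (fun k => (List.perm_append_singleton h p).mem_iff.2 (hall k)) hw]
        rw [List.reverse_cons, act_append]
        rfl

lemma word_prefix : ∀ (l1 : List (Fin n)) (k : ℕ) (p : List (Fin n)) (j : Fin n) (l2 : List (Fin n)),
    word k p = l1 ++ j :: l2 → word (l1.length + 1) p = l1 ++ [j] := by
  intro l1
  induction l1 with
  | nil =>
    intro k p j l2 h
    rcases k with _ | k <;> rcases p with _ | ⟨i, p⟩ <;> simp [word] at h ⊢
    exact h.1
  | cons x l1 ih =>
    intro k p j l2 h
    rcases k with _ | k <;> rcases p with _ | ⟨i, p⟩ <;> simp [word] at h ⊢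
    exact ⟨h.1, ih _ _ _ _ h.2⟩

lemma word_length (k : ℕ) (p : List (Fin n)) (hp : p ≠ []) : (word k p).length = k := by
  induction k generalizing p with
  | zero => rfl
  | succ k ih =>
    rcases p with _ | ⟨i, p⟩
    · exact absurd rfl hp
    · simp [word, ih]

lemma word_add (p q : List (Fin n)) (k : ℕ) :
    word (p.length + k) (p ++ q) = p ++ word k (q ++ p) := by
  induction p generalizing q with
  | nil => simp
  | cons h p ih =>
    have e : (h :: p).length + k = (p.length + k) + 1 := by simp; omega
    rw [e, List.cons_append, word, List.append_assoc, ih]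
    simp

lemma word_pow (p : List (Fin n)) (m : ℕ) : pr A hA (word (m * p.length) p) = (pr A hA p) ^ m := by
  induction m with
  | zero => simp [word, pr_nil]
  | succ m ih =>
    have := word_add p [] (m * p.length)
    simp only [List.append_nil, List.nil_append] at this
    rw [show (m + 1) * p.length = p.length + m * p.length by ring, this, pr_append, ih, pow_succ']

lemma good_word (hsym : ∀ i j, A i j = A j i) (hoff : ∀ i j, i ≠ j → A i j ≤ 0)
    {δ : Fin n → ℝ} (hδ0 : ∀ i, 0 < δ i)
    (hδ : ∀ i, ∑ j, (A i j : ℝ) * δ j ≤ 0) (p : List (Fin n)) (hnd : p.Nodup) (hall : ∀ k, k ∈ p) :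
    ∀ (N : ℕ) (l : List (Fin n)), l.length = N → ∀ k j l2, word k p = l ++ j :: l2 →
      0 ≤ pr A hA l (Pi.single j 1) := by
  intro N
  induction N using Nat.strong_induction_on with
  | _ N ih =>
  intro l hl k j l2 hw
  have hgood : Good A hA l := by
    rintro l1 i l3 rfl
    exact ih l1.length (by simp at hl; omega) l1 rfl k i (l3 ++ j :: l2) (by simpa using hw)
  have hpos : ∀ l1 i l3, l ++ [j] = l1 ++ i :: l3 → Good A hA l1 →
      0 < Ef A p (cst (pr A hA l1 (Pi.single i 1))) δ := by
    intro l1 i l3 h hg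
    have h1 : word k p = l1 ++ i :: (l3 ++ l2) := by
      rw [hw, show l ++ j :: l2 = (l ++ [j]) ++ l2 by simp, h]; simp
    rw [cst_pr, cst_single, Ef_word hsym hA _ p δ l1 i hnd hall (word_prefix _ _ _ _ _ h1)]
    exact (hδ0 i).trans_le (grow hsym hδ l1 hg i)
  by_contra hneg
  obtain ⟨l1, i, l3, rfl, h2⟩ := exists_of_neg hsym hoff l j hneg
  have h3 := hpos (l1 ++ i :: l3) j [] rfl hgood
  have h4 := hpos l1 i (l3 ++ [j]) (by simp) (by
    rintro m1 r m2 rfl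
    exact hgood m1 r (m2 ++ i :: l3) (by simp))
  rw [pr_append, pr_cons, LinearEquiv.mul_apply, LinearEquiv.mul_apply, h2, sig_self, map_neg] at h3
  have h5 : ∀ (q : List (Fin n)) (a : Fin n → ℤ), Ef A q (cst (-a)) δ = - Ef A q (cst a) δ := by
    intro q a
    induction q with
    | nil => simp [Ef]
    | cons x q ihq =>
      have hs : (q.map fun k => (A x k : ℝ) * cst (-a) k).sum =
          - (q.map fun k => (A x k : ℝ) * cst a k).sum := by
        clear ihq
        induction q with
        | nil => simp
        | cons y q ihy =>
          simp only [List.map_cons, List.sum_cons, ihy]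
          simp [cst]
          ring
      simp only [Ef, ihq, hs]
      simp [cst]
      ring
  rw [h5] at h3
  linarith

end realside
section final
variable {n : ℕ} {A : Fin n → Fin n → ℤ} {hA : ∀ i, A i i = 2}

lemma pr_reverse (l : List (Fin n)) : pr A hA l.reverse = (pr A hA l)⁻¹ := by
  rw [eq_inv_iff_mul_eq_one]
  induction l with
  | nil => simp [pr_nil]
  | cons i l ih =>
    rw [List.reverse_cons, pr_append, pr_single, pr_cons, mul_assoc, ← mul_assoc (sigmaE A hA i),
      sig_sq, one_mul, ih]

lemma isW_of_mem {g : (Fin n → ℤ) ≃ₗ[ℤ] (Fin n → ℤ)}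
    (hg : g ∈ Subgroup.closure (Set.range (sigmaE A hA))) : IsW A hA g := by
  induction hg using Subgroup.closure_induction with
  | mem x hx => obtain ⟨i, rfl⟩ := hx; exact isW_sig i
  | one => exact ⟨[], rfl⟩
  | mul x y _ _ hx hy => exact hx.mul hy
  | inv x _ hx => obtain ⟨l, rfl⟩ := hx; exact ⟨l.reverse, (pr_reverse l).symm⟩

lemma pr_mem (l : List (Fin n)) : pr A hA l ∈ Subgroup.closure (Set.range (sigmaE A hA)) := by
  induction l with
  | nil => exact one_mem _
  | cons i l ih => rw [pr_cons]; exact mul_mem (Subgroup.subset_closure ⟨i, rfl⟩) ih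

lemma Bf_cst (v : Fin n → ℤ) : Bf A (cst v) (cst v) = (qf A v : ℝ) := by
  simp [Bf, qf, cst]

lemma finite_of_posdef (hsym : ∀ i j, A i j = A j i) {c : ℝ} (hc : 0 < c)
    (h : ∀ x : Fin n → ℝ, c * ∑ i, x i ^ 2 ≤ Bf A x x) :
    Finite (Subgroup.closure (Set.range (sigmaE A hA))) := by
  obtain ⟨B, hB⟩ := exists_nat_ge (2 / c)
  let T : Set (Fin n → ℤ) := Set.Icc (fun _ => -(B : ℤ)) (fun _ => (B : ℤ))
  have hT : T.Finite := Set.finite_Icc _ _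
  have : Finite T := hT
  have key : ∀ g : Subgroup.closure (Set.range (sigmaE A hA)), ∀ i,
      (g : (Fin n → ℤ) ≃ₗ[ℤ] (Fin n → ℤ)) (Pi.single i 1) ∈ T := by
    rintro ⟨g, hg⟩ i
    obtain ⟨l, rfl⟩ := isW_of_mem hg
    have h1 := qf_pr (hA := hA) hsym l (Pi.single i 1)
    rw [qf_single hA] at h1
    set v := pr A hA l (Pi.single i 1) with hv
    have h2 := h (cst v)
    rw [Bf_cst, h1] at h2
    have h3 : ∀ p, |v p| ≤ (B : ℤ) := by
      intro p
      have h4 : (cst v p) ^ 2 ≤ ∑ i, cst v i ^ 2 :=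
        Finset.single_le_sum (f := fun i => cst v i ^ 2) (fun i _ => sq_nonneg _) (Finset.mem_univ p)
      have h5 : ∑ i, cst v i ^ 2 ≤ 2 / c := by
        rw [le_div_iff₀ hc]
        push_cast at h2
        linarith
      have h6 : ((v p) ^ 2 : ℤ) ≤ (B : ℤ) := by
        have : ((v p : ℝ)) ^ 2 ≤ (B : ℝ) := h4.trans (h5.trans hB)
        exact_mod_cast this
      have h7 : |v p| ≤ |v p| ^ 2 := by
        rcases (abs_nonneg (v p)).eq_or_lt with h | h
        · rw [← h]; simp
        · nlinarith
      rw [sq_abs] at h7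
      omega
    exact ⟨fun p => (abs_le.1 (h3 p)).1, fun p => (abs_le.1 (h3 p)).2⟩
  apply Finite.of_injective
    (fun g : Subgroup.closure (Set.range (sigmaE A hA)) => fun i : Fin n =>
      (⟨(g : (Fin n → ℤ) ≃ₗ[ℤ] (Fin n → ℤ)) (Pi.single i 1), key g i⟩ : T))
  intro g g' hgg
  apply Subtype.ext
  apply LinearEquiv.toLinearMap_injective
  apply LinearMap.pi_ext'
  intro i
  ext1
  have := congrArg Subtype.val (congrFun hgg i)
  simpa using this

lemma Bf_add_single (hsym : ∀ i j, A i j = A j i) (hA : ∀ i, A i i = 2)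
    (y : Fin n → ℝ) (i : Fin n) (t : ℝ) :
    Bf A (y + t • Pi.single i 1) (y + t • Pi.single i 1) =
      Bf A y y + 2 * t * (∑ j, (A i j : ℝ) * y j) + 2 * t ^ 2 := by
  unfold Bf
  have h1 : ∀ k, ∑ j, (A k j : ℝ) * (y + t • (Pi.single i 1 : Fin n → ℝ)) j =
      (∑ j, (A k j : ℝ) * y j) + t * A k i := by
    intro k
    simp [mul_add, Finset.sum_add_distrib, Pi.single_apply]
    ring
  simp only [h1]
  have h2 : ∑ x, y x * (t * (A x i : ℝ)) = t * ∑ l, (A i l : ℝ) * y l := by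
    rw [Finset.mul_sum]
    exact Finset.sum_congr rfl fun x _ => by rw [hsym x i]; ring
  simp only [Pi.add_apply, Pi.smul_apply, smul_eq_mul, add_mul, mul_add, Finset.sum_add_distrib, h2]
  simp [Pi.single_apply, hA]
  ring

lemma exists_delta (hn : 0 < n) (hsym : ∀ i j, A i j = A j i) (hoff : ∀ i j, i ≠ j → A i j ≤ 0)
    (hind : ∀ I : Set (Fin n), I.Nonempty → Iᶜ.Nonempty → ∃ i ∈ I, ∃ j ∈ Iᶜ, A i j ≠ 0)
    (hinf : Infinite (Subgroup.closure (Set.range (sigmaE A hA)))) :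
    ∃ δ : Fin n → ℝ, (∀ i, 0 < δ i) ∧ ∀ i, ∑ j, (A i j : ℝ) * δ j ≤ 0 := by
  let S : Set (Fin n → ℝ) := {x | ∑ i, x i ^ 2 = 1}
  have hSc : IsCompact S := by
    apply Metric.isCompact_of_isClosed_isBounded
    · exact isClosed_eq (by fun_prop) continuous_const
    · refine (Metric.isBounded_closedBall (x := (0 : Fin n → ℝ)) (r := 1)).subset ?_
      intro x hx
      rw [mem_closedBall_zero_iff, pi_norm_le_iff_of_nonneg zero_le_one]
      intro i
      have h4 : x i ^ 2 ≤ ∑ i, x i ^ 2 :=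
        Finset.single_le_sum (f := fun i => x i ^ 2) (fun i _ => sq_nonneg _) (Finset.mem_univ i)
      have hx' : ∑ i, x i ^ 2 = 1 := hx
      rw [Real.norm_eq_abs, abs_le_one_iff_mul_self_le_one]
      nlinarith
  have hSn : S.Nonempty := ⟨Pi.single ⟨0, hn⟩ 1, by simp [S, Pi.single_apply]⟩
  have hcont : Continuous fun x : Fin n → ℝ => Bf A x x := by
    unfold Bf; fun_prop
  obtain ⟨x0, hx0, hmin⟩ := hSc.exists_isMinOn hSn hcont.continuousOn
  have hx0' : ∑ i, x0 i ^ 2 = 1 := hx0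
  set c := Bf A x0 x0 with hc
  have hsmul : ∀ (t : ℝ) (x : Fin n → ℝ), Bf A (t • x) (t • x) = t ^ 2 * Bf A x x := by
    intro t x
    simp only [Bf, Pi.smul_apply, smul_eq_mul, Finset.mul_sum]
    refine Finset.sum_congr rfl fun i _ => Finset.sum_congr rfl fun j _ => by ring
  have hall : ∀ x : Fin n → ℝ, c * ∑ i, x i ^ 2 ≤ Bf A x x := by
    intro x
    have hnn : 0 ≤ ∑ i, x i ^ 2 := Finset.sum_nonneg fun i _ => sq_nonneg _
    rcases hnn.eq_or_lt with h0 | hpos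
    · have hx : x = 0 := by
        ext i
        have := (Finset.sum_eq_zero_iff_of_nonneg (fun i _ => sq_nonneg (x i))).1 h0.symm i
          (Finset.mem_univ i)
        simpa using this
      subst hx
      simp [Bf]
    · set r := ∑ i, x i ^ 2 with hr
      have hs : (√r)⁻¹ • x ∈ S := by
        simp only [S, Set.mem_ofPred_eq, Pi.smul_apply, smul_eq_mul, mul_pow, ← Finset.mul_sum]
        rw [← hr, inv_pow, Real.sq_sqrt hpos.le, inv_mul_cancel₀ hpos.ne']
      have h1 : c ≤ Bf A ((√r)⁻¹ • x) ((√r)⁻¹ • x) := hmin hs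
      rw [hsmul, inv_pow, Real.sq_sqrt hpos.le, inv_mul_eq_div, le_div_iff₀ hpos] at h1
      exact h1
  by_cases hc0 : 0 < c
  · have := finite_of_posdef (hA := hA) hsym hc0 hall
    exact absurd hinf (not_infinite_iff_finite.2 this)
  push Not at hc0
  let y : Fin n → ℝ := fun i => |x0 i|
  have hy0 : ∀ i, 0 ≤ y i := fun i => abs_nonneg _
  have hysq : ∑ i, y i ^ 2 = 1 := by simp [y, hx0']
  have hyle : Bf A y y ≤ c := by
    rw [hc]
    unfold Bf
    simp only [Finset.mul_sum]
    refine Finset.sum_le_sum fun i _ => Finset.sum_le_sum fun j _ => ?_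
    by_cases hij : i = j
    · subst hij
      have : y i * y i = x0 i * x0 i := abs_mul_abs_self _
      rw [hA]
      push_cast
      linarith
    · have h1 : (A i j : ℝ) ≤ 0 := by exact_mod_cast hoff i j hij
      have h2 : x0 i * x0 j ≤ y i * y j := by
        simp only [y]; rw [← abs_mul]; exact le_abs_self _
      nlinarith
  have heig : ∀ i, ∑ j, (A i j : ℝ) * y j = c * y i := by
    intro i
    set e := ∑ j, (A i j : ℝ) * y j - c * y i with he
    have hq : ∀ t : ℝ, 0 ≤ 2 * t * e + t ^ 2 * (2 - c) := by
      intro t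
      have h1 := hall (y + t • Pi.single i 1)
      rw [Bf_add_single hsym hA] at h1
      have h2 : ∑ k, (y + t • (Pi.single i 1 : Fin n → ℝ)) k ^ 2 = 1 + 2 * t * y i + t ^ 2 := by
        simp only [Pi.add_apply, Pi.smul_apply, smul_eq_mul, add_sq, Finset.sum_add_distrib]
        rw [hysq]
        simp [Pi.single_apply]
        ring
      rw [h2] at h1
      rw [he]
      nlinarith
    have h3 := hq (- e / (2 - c))
    have h4 : 0 < 2 - c := by linarith
    have h5 : 2 * (-e / (2 - c)) * e + (-e / (2 - c)) ^ 2 * (2 - c) = - (e ^ 2 / (2 - c)) := by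
      field_simp; ring
    rw [h5] at h3
    have h6 : e ^ 2 / (2 - c) = 0 := le_antisymm (by linarith) (by positivity)
    have h7 : e = 0 := by
      rcases div_eq_zero_iff.1 h6 with h | h
      · simpa using h
      · linarith
    linarith
  refine ⟨y, ?_, fun i => by rw [heig]; exact mul_nonpos_of_nonpos_of_nonneg hc0 (hy0 i)⟩
  by_contra hcon
  push Not at hcon
  obtain ⟨i0, hi0⟩ := hcon
  have hne : ∃ i1, y i1 ≠ 0 := by
    by_contra h
    push Not at h
    simp [h] at hysq
  obtain ⟨i1, hi1⟩ := hne
  obtain ⟨i, hi, j, hj, hij⟩ := hind {i | y i = 0} ⟨i0, le_antisymm hi0 (hy0 _)⟩ ⟨i1, hi1⟩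
  have hi' : y i = 0 := hi
  have hj' : y j ≠ 0 := hj
  have h1 := heig i
  rw [hi', mul_zero] at h1
  have h2 : ∀ k ∈ Finset.univ, (A i k : ℝ) * y k ≤ 0 := by
    intro k _
    by_cases hk : i = k
    · rw [← hk, hi']; simp
    · exact mul_nonpos_of_nonpos_of_nonneg (by exact_mod_cast hoff i k hk) (hy0 k)
  have h3 := (Finset.sum_eq_zero_iff_of_nonpos h2).1 h1 j (Finset.mem_univ j)
  rcases mul_eq_zero.1 h3 with h | h
  · exact hij (by exact_mod_cast h)
  · exact hj' h

end final

theorem weyl_infinite_iff_powers_of_coxeter_reduced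
    (n : ℕ) (hn : 0 < n) (A : Fin n → Fin n → ℤ)
    (hsym : ∀ i j, A i j = A j i)
    (hA : ∀ i, A i i = 2)
    (hoff : ∀ i j, i ≠ j → A i j ≤ 0)
    (hind : ∀ I : Set (Fin n), I.Nonempty → Iᶜ.Nonempty → ∃ i ∈ I, ∃ j ∈ Iᶜ, A i j ≠ 0)
    (v : Equiv.Perm (Fin n)) :
    Infinite (Subgroup.closure (Set.range (sigmaE A hA))) ↔
      ∀ m : ℤ, wordLen A hA ((wordOf A hA (List.ofFn fun t => v t)) ^ m) = m.natAbs * n := by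
  set p := List.ofFn fun t => v t with hp
  have hnd : p.Nodup := List.nodup_ofFn.2 v.injective
  have hall : ∀ k, k ∈ p := fun k => by
    rw [hp, List.mem_ofFn]
    exact v.surjective k
  have hlen : p.length = n := by simp [hp]
  have hw : wordOf A hA p = pr A hA p.reverse := rfl
  constructor
  · intro hinf
    obtain ⟨δ, hδ0, hδ⟩ := exists_delta hn hsym hoff hind hinf
    have main : ∀ (q : List (Fin n)), q.Nodup → (∀ k, k ∈ q) → q.length = n → ∀ m : ℕ,
        wordLen A hA ((pr A hA q) ^ m) = m * n := by
      intro q hq1 hq2 hq3 m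
      have hne : q ≠ [] := by
        rintro rfl
        simp at hq3
        omega
      rw [← word_pow, len_of_good hsym hoff, word_length _ _ hne, hq3]
      intro l1 j l2 h
      exact good_word hsym hoff hδ0 hδ q hq1 hq2 _ l1 rfl _ j l2 h
    intro m
    rcases Int.eq_nat_or_neg m with ⟨k, rfl | rfl⟩
    · rw [zpow_natCast, hw, main p.reverse (List.nodup_reverse.2 hnd) (by simpa using hall)
        (by simpa using hlen)]
      simp
    · rw [zpow_neg, zpow_natCast, ← inv_pow, hw, pr_reverse, inv_inv, main p hnd hall hlen]
      simp
  · intro h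
    by_contra hfin
    rw [not_infinite_iff_finite] at hfin
    have hmem : wordOf A hA p ∈ Subgroup.closure (Set.range (sigmaE A hA)) := by
      rw [hw]; exact pr_mem _
    have h1 := orderOf_pos (⟨_, hmem⟩ : Subgroup.closure (Set.range (sigmaE A hA)))
    have h2 := pow_orderOf_eq_one (⟨_, hmem⟩ : Subgroup.closure (Set.range (sigmaE A hA)))
    set r := orderOf (⟨_, hmem⟩ : Subgroup.closure (Set.range (sigmaE A hA)))
    have h3 : wordOf A hA p ^ r = 1 := congrArg Subtype.val h2
    have h4 := h (r : ℤ)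
    rw [zpow_natCast, h3] at h4
    have h5 := len_le (A := A) (hA := hA) []
    rw [pr_nil, h4] at h5
    simp at h5
    omega

end KP
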